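/- arXiv:solv-int/9511008 — 11 statements merged into one kernel-verified Lean document; each statement's English description precedes it below -/
import Mathlib

section
/- Let u : ℝ × ℝ → ℝ be a smooth function of (x,t) satisfying the continuous Toda equation ∂²u/∂t² = ∂²(e^u)/∂x². Let m : ℝ → ℂ be twice differentiable with m''(s) = e^s · m(s) for all s ∈ ℝ, and set p = m'. Suppose y₁ : ℝ × ℝ → ℝ satisfies ∂y₁/∂x = ∂u/∂t and ∂y₁/∂t = e^u · ∂u/∂x, and y₂ : ℝ × ℝ → ℂ satisfies ∂y₂/∂x = −i·m(u(x,t))·cosh(y₁(x,t)) and ∂y₂/∂t = −i·p(u(x,t))·sinh(y₁(x,t)). Then y₂ satisfies the wave equation ∂²y₂/∂t² − e^u · ∂²y₂/∂x² = 0. -/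
/-- Proposition 1: if `u` solves the continuous Toda equation `u_tt = (e^u)_xx`,
`m'' = e^s · m` with `p = m'`, and the pseudopotential components `y₁, y₂` satisfy
the prolongation system, then `y₂` solves the wave equation `y₂_tt − e^u · y₂_xx = 0`. -/
theorem toda_pseudopotential_wave_equation
    (u : ℝ × ℝ → ℝ) (y₁ : ℝ × ℝ → ℝ) (y₂ : ℝ × ℝ → ℂ) (m p : ℝ → ℂ)
    (hu : ContDiff ℝ (⊤ : ℕ∞) u) (hy₁ : ContDiff ℝ (⊤ : ℕ∞) y₁) (hy₂ : ContDiff ℝ (⊤ : ℕ∞) y₂)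
    (hm : ∀ s : ℝ, HasDerivAt m (p s) s)
    (hp : ∀ s : ℝ, HasDerivAt p ((Real.exp s : ℂ) * m s) s)
    (hToda : ∀ x t : ℝ,
      deriv (fun t' => deriv (fun t'' => u (x, t'')) t') t =
        deriv (fun x' => deriv (fun x'' => Real.exp (u (x'', t))) x') x)
    (hy₁x : ∀ x t : ℝ,
      deriv (fun x' => y₁ (x', t)) x = deriv (fun t' => u (x, t')) t)
    (hy₁t : ∀ x t : ℝ,
      deriv (fun t' => y₁ (x, t')) t = Real.exp (u (x, t)) * deriv (fun x' => u (x', t)) x)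
    (hy₂x : ∀ x t : ℝ,
      deriv (fun x' => y₂ (x', t)) x =
        -Complex.I * m (u (x, t)) * Complex.cosh (y₁ (x, t) : ℂ))
    (hy₂t : ∀ x t : ℝ,
      deriv (fun t' => y₂ (x, t')) t =
        -Complex.I * p (u (x, t)) * Complex.sinh (y₁ (x, t) : ℂ)) :
    ∀ x t : ℝ,
      deriv (fun t' => deriv (fun t'' => y₂ (x, t'')) t') t -
        (Real.exp (u (x, t)) : ℂ) * deriv (fun x' => deriv (fun x'' => y₂ (x'', t)) x') x = 0 := by
  intro x t
  have hud : Differentiable ℝ u := hu.differentiable (by simp)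
  have hyd : Differentiable ℝ y₁ := hy₁.differentiable (by simp)
  have hux : HasDerivAt (fun x' => u (x', t)) (deriv (fun x' => u (x', t)) x) x :=
    DifferentiableAt.hasDerivAt (by fun_prop)
  have hut : HasDerivAt (fun t' => u (x, t')) (deriv (fun t' => u (x, t')) t) t :=
    DifferentiableAt.hasDerivAt (by fun_prop)
  have hyx : HasDerivAt (fun x' => y₁ (x', t)) (deriv (fun t' => u (x, t')) t) x := by
    rw [← hy₁x]
    exact DifferentiableAt.hasDerivAt (by fun_prop)
  have hyt : HasDerivAt (fun t' => y₁ (x, t'))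
      (Real.exp (u (x, t)) * deriv (fun x' => u (x', t)) x) t := by
    rw [← hy₁t]
    exact DifferentiableAt.hasDerivAt (by fun_prop)
  have h1 := ((((hp (u (x, t))).scomp t hut).const_mul (-Complex.I)).mul
    ((Complex.hasDerivAt_sinh (y₁ (x, t) : ℂ)).scomp t hyt.ofReal_comp)).deriv
  have h2 := ((((hm (u (x, t))).scomp x hux).const_mul (-Complex.I)).mul
    ((Complex.hasDerivAt_cosh (y₁ (x, t) : ℂ)).scomp x hyx.ofReal_comp)).deriv
  simp only [hy₂x, hy₂t]
  refine (congrArg₂ (fun a b => a - (Real.exp (u (x, t)) : ℂ) * b) h1 h2).trans ?_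
  simp only [Function.comp, Complex.real_smul, smul_eq_mul]
  push_cast
  ring
end

section
/- Consider the linear differential operators acting on smooth functions f : ℝ³ → ℝ of the variables (t,x,u): Y = (t²/2)∂_t − 2t∂_u, Z = t∂_t − 2∂_u, X₁ = t∂_t + x∂_x + ε((t²/2)∂_t − 2t∂_u), X₂ = ∂_t, X₃ = ∂_x, X₄ = x∂_x + 2∂_u, where ε ∈ ℝ. Let C be the operator C = 8·X₂∘Y − 4·Z∘Z − 4·Z (compositions of operators). Then C commutes with each of the operators Y, Z, X₁, X₂, X₃, X₄, i.e. C∘W − W∘C = 0 on smooth functions for every W in {Y, Z, X₁, X₂, X₃, X₄}. -/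
/-- Partial derivative in the first variable `t` of a function of `(t,x,u)`. -/
noncomputable def Dt (f : ℝ × ℝ × ℝ → ℝ) (q : ℝ × ℝ × ℝ) : ℝ :=
  deriv (fun s => f (s, q.2.1, q.2.2)) q.1

/-- Partial derivative in the second variable `x`. -/
noncomputable def Dx (f : ℝ × ℝ × ℝ → ℝ) (q : ℝ × ℝ × ℝ) : ℝ :=
  deriv (fun s => f (q.1, s, q.2.2)) q.2.1

/-- Partial derivative in the third variable `u`. -/
noncomputable def Du (f : ℝ × ℝ × ℝ → ℝ) (q : ℝ × ℝ × ℝ) : ℝ :=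
  deriv (fun s => f (q.1, q.2.1, s)) q.2.2

/-- `Y = (t²/2)∂_t − 2t∂_u`. -/
noncomputable def Yop (f : ℝ × ℝ × ℝ → ℝ) (q : ℝ × ℝ × ℝ) : ℝ :=
  q.1 ^ 2 / 2 * Dt f q - 2 * q.1 * Du f q

/-- `Z = t∂_t − 2∂_u`. -/
noncomputable def Zop (f : ℝ × ℝ × ℝ → ℝ) (q : ℝ × ℝ × ℝ) : ℝ :=
  q.1 * Dt f q - 2 * Du f q

/-- `X₁ = t∂_t + x∂_x + ε((t²/2)∂_t − 2t∂_u)`. -/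
noncomputable def X1op (ε : ℝ) (f : ℝ × ℝ × ℝ → ℝ) (q : ℝ × ℝ × ℝ) : ℝ :=
  q.1 * Dt f q + q.2.1 * Dx f q + ε * (q.1 ^ 2 / 2 * Dt f q - 2 * q.1 * Du f q)

/-- `X₂ = ∂_t`. -/
noncomputable def X2op (f : ℝ × ℝ × ℝ → ℝ) (q : ℝ × ℝ × ℝ) : ℝ := Dt f q

/-- `X₃ = ∂_x`. -/
noncomputable def X3op (f : ℝ × ℝ × ℝ → ℝ) (q : ℝ × ℝ × ℝ) : ℝ := Dx f q

/-- `X₄ = x∂_x + 2∂_u`. -/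
noncomputable def X4op (f : ℝ × ℝ × ℝ → ℝ) (q : ℝ × ℝ × ℝ) : ℝ :=
  q.2.1 * Dx f q + 2 * Du f q

/-- The Casimir operator `C = 8·X₂∘Y − 4·Z∘Z − 4·Z`. -/
noncomputable def Cop (f : ℝ × ℝ × ℝ → ℝ) (q : ℝ × ℝ × ℝ) : ℝ :=
  8 * X2op (Yop f) q - 4 * Zop (Zop f) q - 4 * Zop f q

abbrev Sm (f : ℝ × ℝ × ℝ → ℝ) : Prop := ContDiff ℝ (⊤ : ℕ∞) f

theorem Sm.da {f : ℝ × ℝ × ℝ → ℝ} (hf : Sm f) : Differentiable ℝ f :=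
  ContDiff.differentiable hf (by simp)

theorem hasDt {f : ℝ × ℝ × ℝ → ℝ} (hf : Differentiable ℝ f) (q : ℝ × ℝ × ℝ) :
    HasDerivAt (fun s => f (s, q.2.1, q.2.2)) (fderiv ℝ f q (1, 0, 0)) q.1 := by
  have h : HasDerivAt (fun s : ℝ => (s, q.2.1, q.2.2)) ((1, 0, 0) : ℝ × ℝ × ℝ) q.1 :=
    (hasDerivAt_id q.1).prodMk ((hasDerivAt_const _ _).prodMk (hasDerivAt_const _ _))
  exact (hf q).hasFDerivAt.comp_hasDerivAt q.1 h

theorem hasDx {f : ℝ × ℝ × ℝ → ℝ} (hf : Differentiable ℝ f) (q : ℝ × ℝ × ℝ) :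
    HasDerivAt (fun s => f (q.1, s, q.2.2)) (fderiv ℝ f q (0, 1, 0)) q.2.1 := by
  have h : HasDerivAt (fun s : ℝ => (q.1, s, q.2.2)) ((0, 1, 0) : ℝ × ℝ × ℝ) q.2.1 :=
    (hasDerivAt_const _ _).prodMk ((hasDerivAt_id q.2.1).prodMk (hasDerivAt_const _ _))
  exact (hf q).hasFDerivAt.comp_hasDerivAt q.2.1 h

theorem hasDu {f : ℝ × ℝ × ℝ → ℝ} (hf : Differentiable ℝ f) (q : ℝ × ℝ × ℝ) :
    HasDerivAt (fun s => f (q.1, q.2.1, s)) (fderiv ℝ f q (0, 0, 1)) q.2.2 := by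
  have h : HasDerivAt (fun s : ℝ => (q.1, q.2.1, s)) ((0, 0, 1) : ℝ × ℝ × ℝ) q.2.2 :=
    (hasDerivAt_const _ _).prodMk ((hasDerivAt_const _ _).prodMk (hasDerivAt_id q.2.2))
  exact (hf q).hasFDerivAt.comp_hasDerivAt q.2.2 h

theorem Dt_eq {f : ℝ × ℝ × ℝ → ℝ} (hf : Sm f) : Dt f = fun q => fderiv ℝ f q (1, 0, 0) :=
  funext fun q => (hasDt hf.da q).deriv
theorem Dx_eq {f : ℝ × ℝ × ℝ → ℝ} (hf : Sm f) : Dx f = fun q => fderiv ℝ f q (0, 1, 0) :=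
  funext fun q => (hasDx hf.da q).deriv
theorem Du_eq {f : ℝ × ℝ × ℝ → ℝ} (hf : Sm f) : Du f = fun q => fderiv ℝ f q (0, 0, 1) :=
  funext fun q => (hasDu hf.da q).deriv

theorem sm_dir {f : ℝ × ℝ × ℝ → ℝ} (hf : Sm f) (v : ℝ × ℝ × ℝ) :
    Sm (fun q => fderiv ℝ f q v) :=
  (ContDiff.fderiv_right (m := (⊤ : ℕ∞)) hf (by simp)).clm_apply contDiff_const

theorem sm_Dt {f : ℝ × ℝ × ℝ → ℝ} (hf : Sm f) : Sm (Dt f) := by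
  rw [Dt_eq hf]; exact sm_dir hf _
theorem sm_Dx {f : ℝ × ℝ × ℝ → ℝ} (hf : Sm f) : Sm (Dx f) := by
  rw [Dx_eq hf]; exact sm_dir hf _
theorem sm_Du {f : ℝ × ℝ × ℝ → ℝ} (hf : Sm f) : Sm (Du f) := by
  rw [Du_eq hf]; exact sm_dir hf _

theorem dir_comm {f : ℝ × ℝ × ℝ → ℝ} (hf : Sm f) (v w q : ℝ × ℝ × ℝ) :
    fderiv ℝ (fun p => fderiv ℝ f p v) q w = fderiv ℝ (fun p => fderiv ℝ f p w) q v := by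
  have hd : DifferentiableAt ℝ (fderiv ℝ f) q :=
    (ContDiff.fderiv_right (m := 1) hf (by norm_cast)).differentiable (by simp) q
  have hs : IsSymmSndFDerivAt ℝ f q := hf.contDiffAt.isSymmSndFDerivAt (by
    simp only [minSmoothness_of_isRCLikeNormedField]
    norm_cast)
  rw [fderiv_clm_apply hd (by fun_prop), fderiv_clm_apply hd (by fun_prop)]
  simpa using hs.eq w v

theorem Du_Dt {f : ℝ × ℝ × ℝ → ℝ} (hf : Sm f) (q : ℝ × ℝ × ℝ) : Du (Dt f) q = Dt (Du f) q := by
  rw [Du_eq (sm_Dt hf), Dt_eq (sm_Du hf), Dt_eq hf, Du_eq hf]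
  exact dir_comm hf _ _ q
theorem Du_Dx {f : ℝ × ℝ × ℝ → ℝ} (hf : Sm f) (q : ℝ × ℝ × ℝ) : Du (Dx f) q = Dx (Du f) q := by
  rw [Du_eq (sm_Dx hf), Dx_eq (sm_Du hf), Dx_eq hf, Du_eq hf]
  exact dir_comm hf _ _ q

/-- The Casimir operator simplifies to `-8 ∂_u - 16 ∂_u²`. -/
theorem Cop_eq {f : ℝ × ℝ × ℝ → ℝ} (hf : Sm f) (q : ℝ × ℝ × ℝ) :
    Cop f q = -8 * Du f q - 16 * Du (Du f) q := by
  have htt := (hasDt (sm_Dt hf).da q).differentiableAt.hasDerivAt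
  have htu := (hasDt (sm_Du hf).da q).differentiableAt.hasDerivAt
  have hut := (hasDu (sm_Dt hf).da q).differentiableAt.hasDerivAt
  have huu := (hasDu (sm_Du hf).da q).differentiableAt.hasDerivAt
  have hid := hasDerivAt_id q.1
  have h1 : Dt (Yop f) q = q.1 * Dt f q + q.1 ^ 2 / 2 * Dt (Dt f) q
      - (2 * Du f q + 2 * q.1 * Dt (Du f) q) := by
    have := ((((hid.pow 2).div_const 2).mul htt).sub ((hid.const_mul 2).mul htu)).deriv
    refine Eq.trans this ?_
    simp [Dt]
  have h2 : Dt (Zop f) q = Dt f q + q.1 * Dt (Dt f) q - 2 * Dt (Du f) q := by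
    have := ((hid.mul htt).sub (htu.const_mul 2)).deriv
    refine Eq.trans this ?_
    simp [Dt]
  have h3 : Du (Zop f) q = q.1 * Du (Dt f) q - 2 * Du (Du f) q := by
    exact ((hut.const_mul q.1).sub (huu.const_mul 2)).deriv
  have h4 : Zop (Zop f) q = q.1 * Dt (Zop f) q - 2 * Du (Zop f) q := rfl
  unfold Cop
  rw [h4]
  unfold X2op
  rw [h1, h2, h3, Du_Dt hf]
  unfold Zop
  ring

/-- First order operator with coefficients depending on `(t,x)` only. -/
noncomputable def Wop (a b c : ℝ → ℝ → ℝ) (f : ℝ × ℝ × ℝ → ℝ) (q : ℝ × ℝ × ℝ) : ℝ :=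
  a q.1 q.2.1 * Dt f q + b q.1 q.2.1 * Dx f q + c q.1 q.2.1 * Du f q

theorem Du_Wop (a b c : ℝ → ℝ → ℝ) {f : ℝ × ℝ × ℝ → ℝ} (hf : Sm f) :
    Du (Wop a b c f) = Wop a b c (Du f) := by
  funext q
  have ht := (hasDu (sm_Dt hf).da q).differentiableAt.hasDerivAt
  have hx := (hasDu (sm_Dx hf).da q).differentiableAt.hasDerivAt
  have hu := (hasDu (sm_Du hf).da q).differentiableAt.hasDerivAt
  have := (((ht.const_mul (a q.1 q.2.1)).add (hx.const_mul (b q.1 q.2.1))).add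
    (hu.const_mul (c q.1 q.2.1))).deriv
  refine Eq.trans this ?_
  change a q.1 q.2.1 * Du (Dt f) q + b q.1 q.2.1 * Du (Dx f) q + c q.1 q.2.1 * Du (Du f) q = _
  rw [Du_Dt hf, Du_Dx hf]
  rfl

theorem Cop_Wop (a b c : ℝ → ℝ → ℝ)
    (ha : Sm fun q => a q.1 q.2.1) (hb : Sm fun q => b q.1 q.2.1) (hc : Sm fun q => c q.1 q.2.1)
    {f : ℝ × ℝ × ℝ → ℝ} (hf : Sm f) (q : ℝ × ℝ × ℝ) :
    Cop (Wop a b c f) q - Wop a b c (Cop f) q = 0 := by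
  have hW : Sm (Wop a b c f) :=
    ((ha.mul (sm_Dt hf)).add (hb.mul (sm_Dx hf))).add (hc.mul (sm_Du hf))
  rw [Cop_eq hW, Du_Wop a b c hf, Du_Wop a b c (sm_Du hf), funext (Cop_eq hf)]
  have h1 := (sm_Du hf).da
  have h2 := (sm_Du (sm_Du hf)).da
  have et : Dt (fun q => -8 * Du f q - 16 * Du (Du f) q) q
      = -8 * Dt (Du f) q - 16 * Dt (Du (Du f)) q :=
    (((hasDt h1 q).differentiableAt.hasDerivAt.const_mul (-8)).sub
      ((hasDt h2 q).differentiableAt.hasDerivAt.const_mul 16)).deriv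
  have ex : Dx (fun q => -8 * Du f q - 16 * Du (Du f) q) q
      = -8 * Dx (Du f) q - 16 * Dx (Du (Du f)) q :=
    (((hasDx h1 q).differentiableAt.hasDerivAt.const_mul (-8)).sub
      ((hasDx h2 q).differentiableAt.hasDerivAt.const_mul 16)).deriv
  have eu : Du (fun q => -8 * Du f q - 16 * Du (Du f) q) q
      = -8 * Du (Du f) q - 16 * Du (Du (Du f)) q :=
    (((hasDu h1 q).differentiableAt.hasDerivAt.const_mul (-8)).sub
      ((hasDu h2 q).differentiableAt.hasDerivAt.const_mul 16)).deriv
  unfold Wop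
  rw [et, ex, eu]
  ring

/-- Proposition 2: the Casimir operator `C = 4[2X₂Y − Z(Z+1)]` commutes with all the
generators `Y, Z, X₁, X₂, X₃, X₄` on smooth functions. -/
theorem casimir_commutes (ε : ℝ) (f : ℝ × ℝ × ℝ → ℝ) (hf : ContDiff ℝ (⊤ : ℕ∞) f)
    (q : ℝ × ℝ × ℝ) :
    Cop (Yop f) q - Yop (Cop f) q = 0 ∧
    Cop (Zop f) q - Zop (Cop f) q = 0 ∧
    Cop (X1op ε f) q - X1op ε (Cop f) q = 0 ∧
    Cop (X2op f) q - X2op (Cop f) q = 0 ∧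
    Cop (X3op f) q - X3op (Cop f) q = 0 ∧
    Cop (X4op f) q - X4op (Cop f) q = 0 := by
  have key : ∀ (W : (ℝ × ℝ × ℝ → ℝ) → ℝ × ℝ × ℝ → ℝ) (a b c : ℝ → ℝ → ℝ),
      W = Wop a b c → (Sm fun q => a q.1 q.2.1) → (Sm fun q => b q.1 q.2.1) →
      (Sm fun q => c q.1 q.2.1) → Cop (W f) q - W (Cop f) q = 0 := by
    rintro W a b c rfl ha hb hc
    exact Cop_Wop a b c ha hb hc hf q
  refine ⟨key Yop (fun t _ => t ^ 2 / 2) (fun _ _ => 0) (fun t _ => -2 * t) ?_ ?_ ?_ ?_,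
    key Zop (fun t _ => t) (fun _ _ => 0) (fun _ _ => -2) ?_ ?_ ?_ ?_,
    key (X1op ε) (fun t _ => t + ε * (t ^ 2 / 2)) (fun _ x => x) (fun t _ => -2 * ε * t)
      ?_ ?_ ?_ ?_,
    key X2op (fun _ _ => 1) (fun _ _ => 0) (fun _ _ => 0) ?_ ?_ ?_ ?_,
    key X3op (fun _ _ => 0) (fun _ _ => 1) (fun _ _ => 0) ?_ ?_ ?_ ?_,
    key X4op (fun _ _ => 0) (fun _ x => x) (fun _ _ => 2) ?_ ?_ ?_ ?_⟩
  all_goals first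
    | (unfold Sm; fun_prop)
    | (funext g p
       simp only [Yop, Zop, X1op, X2op, X3op, X4op, Wop]
       ring)
end

section
/- Let 𝔤 be a Lie algebra over ℝ, let ε ∈ ℝ, and let L, a₀, a₁, b₀, b₁ ∈ 𝔤 satisfy: ⁅b₀,L⁆ = ε·L, ⁅L,a₀⁆ = b₁, ⁅L,b₁⁆ = a₁, ⁅a₀,b₀⁆ = 0, and ⁅a₀,b₁⁆ + ⁅a₁,b₀⁆ = 0. Then the following identities hold: (i) ⁅b₀,b₁⁆ = ε·b₁; (ii) ⁅b₀,a₁⁆ = 2ε·a₁; (iii) ⁅a₀,b₁⁆ = 2ε·a₁. -/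
/-- Relations (A3), (A4), (A5) of Appendix B: from the prolongation commutation
relations of `u_tt + ε u_t = (e^u)_xx` one derives `[b₀,b₁] = ε b₁`,
`[b₀,a₁] = 2ε a₁` and `[a₀,b₁] = 2ε a₁`. -/
theorem prolongation_intermediate_relations {𝔤 : Type*} [LieRing 𝔤] [LieAlgebra ℝ 𝔤]
    (ε : ℝ) (L a₀ a₁ b₀ b₁ : 𝔤)
    (h1 : ⁅b₀, L⁆ = ε • L)
    (h2 : ⁅L, a₀⁆ = b₁)
    (h3 : ⁅L, b₁⁆ = a₁)
    (h4 : ⁅a₀, b₀⁆ = 0)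
    (h5 : ⁅a₀, b₁⁆ + ⁅a₁, b₀⁆ = 0) :
    ⁅b₀, b₁⁆ = ε • b₁ ∧ ⁅b₀, a₁⁆ = (2 * ε) • a₁ ∧ ⁅a₀, b₁⁆ = (2 * ε) • a₁ := by
  have h4' : ⁅b₀, a₀⁆ = 0 := by rw [← lie_skew, h4, neg_zero]
  have i1 : ⁅b₀, b₁⁆ = ε • b₁ := by
    have h := leibniz_lie b₀ L a₀
    rwa [h1, h4', h2, smul_lie, h2, lie_zero, add_zero] at h
  have i2 : ⁅b₀, a₁⁆ = (2 * ε) • a₁ := by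
    have h := leibniz_lie b₀ L b₁
    rw [h1, i1, h3, smul_lie, lie_smul, h3] at h
    rw [h, two_mul, add_smul]
  refine ⟨i1, i2, ?_⟩
  rw [eq_neg_of_add_eq_zero_left h5, lie_skew, i2]
end

section
/- Let 𝔤 be a Lie algebra over ℝ and let L, a₀, a₁, b₀, b₁ ∈ 𝔤 satisfy: ⁅b₀,L⁆ = 0, ⁅L,a₀⁆ = b₁, ⁅L,b₁⁆ = a₁, ⁅L,a₁⁆ = 0, ⁅a₀,b₀⁆ = 0, ⁅a₀,b₁⁆ + ⁅a₁,b₀⁆ = 0, and ⁅a₁,b₁⁆ = 0. Then all the remaining mutual brackets vanish: ⁅a₀,a₁⁆ = 0, ⁅a₀,b₁⁆ = 0, ⁅a₁,b₀⁆ = 0, ⁅b₀,b₁⁆ = 0, and ⁅b₀,a₁⁆ = 0. Hence the five elements a₀, a₁, b₀, b₁, L span a Lie subalgebra whose only nonvanishing brackets are ⁅a₀,L⁆ = −b₁ and ⁅b₁,L⁆ = −a₁. -/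
/-- The five-element closed prolongation Lie algebra (relations (153)) of the
continuous Toda equation `u_tt = (e^u)_xx` (second step of Sec. III): all mutual
brackets of `a₀, a₁, b₀, b₁` vanish, so the only nonvanishing brackets of the
algebra spanned by `a₀, a₁, b₀, b₁, L` are `⁅a₀,L⁆ = −b₁` and `⁅b₁,L⁆ = −a₁`. -/
theorem five_element_prolongation_algebra {𝔤 : Type*} [LieRing 𝔤] [LieAlgebra ℝ 𝔤]
    (L a₀ a₁ b₀ b₁ : 𝔤)
    (h1 : ⁅b₀, L⁆ = 0)
    (h2 : ⁅L, a₀⁆ = b₁)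
    (h3 : ⁅L, b₁⁆ = a₁)
    (h4 : ⁅L, a₁⁆ = 0)
    (h5 : ⁅a₀, b₀⁆ = 0)
    (h6 : ⁅a₀, b₁⁆ + ⁅a₁, b₀⁆ = 0)
    (h7 : ⁅a₁, b₁⁆ = 0) :
    ⁅a₀, a₁⁆ = 0 ∧ ⁅a₀, b₁⁆ = 0 ∧ ⁅a₁, b₀⁆ = 0 ∧ ⁅b₀, b₁⁆ = 0 ∧ ⁅b₀, a₁⁆ = 0 ∧
    ⁅a₀, L⁆ = -b₁ ∧ ⁅b₁, L⁆ = -a₁ := by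
  have hL : ⁅L, b₀⁆ = 0 := by rw [← lie_skew, h1, neg_zero]
  have e1 : ⁅b₁, b₀⁆ = 0 := by
    have h := leibniz_lie L a₀ b₀
    rw [h5, h2, hL, lie_zero, lie_zero, add_zero] at h
    exact h.symm
  have e2 : ⁅a₁, b₀⁆ = 0 := by
    have h := leibniz_lie L b₁ b₀
    rw [e1, h3, hL, lie_zero, lie_zero, add_zero] at h
    exact h.symm
  have e3 : ⁅a₀, b₁⁆ = 0 := by rwa [e2, add_zero] at h6
  have e4 : ⁅a₀, a₁⁆ = 0 := by
    have h := leibniz_lie L a₀ b₁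
    rw [e3, h2, h3, lie_self, lie_zero, zero_add] at h
    exact h.symm
  refine ⟨e4, e3, e2, ?_, ?_, ?_, ?_⟩
  · rw [← lie_skew, e1, neg_zero]
  · rw [← lie_skew, e2, neg_zero]
  · rw [← lie_skew, h2]
  · rw [← lie_skew, h3]
end

section
/- Let 𝔤 be a Lie algebra over ℝ and let L, a₀, a₁, a₂, b₀, b₁, b₂ ∈ 𝔤 satisfy: ⁅b₀,L⁆ = 0, ⁅L,a₀⁆ = b₁, ⁅L,a₁⁆ = 2·b₂, ⁅L,a₂⁆ = 0, ⁅L,b₁⁆ = a₁, ⁅L,b₂⁆ = 2·a₂, ⁅a₀,b₀⁆ = 0, ⁅a₀,b₁⁆ + ⁅a₁,b₀⁆ = 0, ⁅a₀,b₂⁆ + ⁅a₁,b₁⁆ + ⁅a₂,b₀⁆ = 0, ⁅a₁,b₂⁆ + ⁅a₂,b₁⁆ = 0, and ⁅a₂,b₂⁆ = 0. Then every bracket among the six elements a₀, a₁, a₂, b₀, b₁, b₂ vanishes: ⁅a_j,a_k⁆ = 0, ⁅a_j,b_k⁆ = 0, and ⁅b_j,b_k⁆ = 0 for all j, k ∈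 {0,1,2}. -/
/-- The seven-element closed prolongation Lie algebra (relations (157)) of the
continuous Toda equation `u_tt = (e^u)_xx` (third step of Sec. III): every
bracket among `a₀, a₁, a₂, b₀, b₁, b₂` vanishes. -/
theorem seven_element_prolongation_algebra {𝔤 : Type*} [LieRing 𝔤] [LieAlgebra ℝ 𝔤]
    (L a₀ a₁ a₂ b₀ b₁ b₂ : 𝔤)
    (h1 : ⁅b₀, L⁆ = 0)
    (h2 : ⁅L, a₀⁆ = b₁)
    (h3 : ⁅L, a₁⁆ = (2 : ℝ) • b₂)
    (h4 : ⁅L, a₂⁆ = 0)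
    (h5 : ⁅L, b₁⁆ = a₁)
    (h6 : ⁅L, b₂⁆ = (2 : ℝ) • a₂)
    (h7 : ⁅a₀, b₀⁆ = 0)
    (h8 : ⁅a₀, b₁⁆ + ⁅a₁, b₀⁆ = 0)
    (h9 : ⁅a₀, b₂⁆ + ⁅a₁, b₁⁆ + ⁅a₂, b₀⁆ = 0)
    (h10 : ⁅a₁, b₂⁆ + ⁅a₂, b₁⁆ = 0)
    (h11 : ⁅a₂, b₂⁆ = 0) :
    ∀ j k : Fin 3,
      ⁅![a₀, a₁, a₂] j, ![a₀, a₁, a₂] k⁆ = 0 ∧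
      ⁅![a₀, a₁, a₂] j, ![b₀, b₁, b₂] k⁆ = 0 ∧
      ⁅![b₀, b₁, b₂] j, ![b₀, b₁, b₂] k⁆ = 0 := by
  have hb : ⁅L, b₀⁆ = 0 := by rw [← lie_skew, h1, neg_zero]
  -- the derivation `ad L` applied to a vanishing bracket
  have D : ∀ x y : 𝔤, ⁅x, y⁆ = 0 → ⁅⁅L, x⁆, y⁆ + ⁅x, ⁅L, y⁆⁆ = 0 := by
    intro x y h
    rw [← leibniz_lie, h, lie_zero]
  have half : ∀ x : 𝔤, (2 : ℝ) • x = 0 → x = 0 := by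
    intro x h
    exact (smul_eq_zero.mp h).resolve_left two_ne_zero
  -- `b₀` commutes with everything
  have b1b0 : ⁅b₁, b₀⁆ = 0 := by simpa [h2, hb] using D _ _ h7
  have a1b0 : ⁅a₁, b₀⁆ = 0 := by simpa [h5, hb] using D _ _ b1b0
  have b2b0 : ⁅b₂, b₀⁆ = 0 := half _ (by simpa only [h3, hb, lie_zero, add_zero, smul_lie] using D _ _ a1b0)
  have a2b0 : ⁅a₂, b₀⁆ = 0 := half _ (by simpa only [h6, hb, lie_zero, add_zero, smul_lie] using D _ _ b2b0)
  have a0b1 : ⁅a₀, b₁⁆ = 0 := by simpa [a1b0] using h8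
  have a0a1 : ⁅a₀, a₁⁆ = 0 := by simpa [h2, h5] using D _ _ a0b1
  have e1 : ⁅b₁, a₁⁆ + (2 : ℝ) • ⁅a₀, b₂⁆ = 0 := by
    simpa only [h2, h3, lie_smul] using D _ _ a0a1
  have e2 : ⁅a₀, b₂⁆ = ⁅b₁, a₁⁆ := by
    rw [a2b0, add_zero] at h9
    rw [← lie_skew b₁ a₁]
    exact eq_neg_of_add_eq_zero_left h9
  have b1a1 : ⁅b₁, a₁⁆ = 0 := by
    rw [e2] at e1
    have : (3 : ℝ) • ⁅b₁, a₁⁆ = 0 := by rw [← e1]; module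
    exact (smul_eq_zero.mp this).resolve_left three_ne_zero
  have a0b2 : ⁅a₀, b₂⁆ = 0 := e2.trans b1a1
  have b1b2 : ⁅b₁, b₂⁆ = 0 :=
    half _ (by simpa only [h5, h3, lie_smul, lie_self, zero_add] using D _ _ b1a1)
  have a0a2 : ⁅a₀, a₂⁆ = 0 :=
    half _ (by simpa only [h2, h6, lie_smul, b1b2, zero_add] using D _ _ a0b2)
  have e3 : ⁅a₁, b₂⁆ + (2 : ℝ) • ⁅b₁, a₂⁆ = 0 := by
    simpa only [h5, h6, lie_smul] using D _ _ b1b2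
  have e4 : ⁅a₁, b₂⁆ = ⁅b₁, a₂⁆ := by
    rw [← lie_skew b₁ a₂]
    exact eq_neg_of_add_eq_zero_left h10
  have b1a2 : ⁅b₁, a₂⁆ = 0 := by
    rw [e4] at e3
    have : (3 : ℝ) • ⁅b₁, a₂⁆ = 0 := by rw [← e3]; module
    exact (smul_eq_zero.mp this).resolve_left three_ne_zero
  have a1b2 : ⁅a₁, b₂⁆ = 0 := e4.trans b1a2
  have a1a2 : ⁅a₁, a₂⁆ = 0 :=
    half _ (by simpa only [h3, h6, lie_smul, smul_lie, lie_self, smul_zero, zero_add] using D _ _ a1b2)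
  have sk : ∀ x y : 𝔤, ⁅x, y⁆ = 0 → ⁅y, x⁆ = 0 := by
    intro x y h
    rw [← lie_skew, h, neg_zero]
  intro j k
  fin_cases j <;> fin_cases k <;>
    simp [h7, h11, b1b0, a1b0, b2b0, a2b0, a0b1, a0a1, b1a1, a0b2, b1b2, a0a2, b1a2, a1b2, a1a2,
      sk _ _ b1b0, sk _ _ b2b0, sk _ _ a0a1, sk _ _ b1a1, sk _ _ b1b2, sk _ _ a0a2,
      sk _ _ b1a2, sk _ _ a1a2]
end

section
/- Let 𝔤 be a Lie algebra over ℝ and let L, a₀, a₁, a₂, a₃, b₀, b₁, b₂, b₃ ∈ 𝔤 satisfy: ⁅b₀,L⁆ = 0, ⁅L,a₀⁆ = b₁, ⁅L,a₁⁆ = 2·b₂, ⁅L,a₂⁆ = 3·b₃, ⁅L,a₃⁆ = 0, ⁅L,b₁⁆ = a₁, ⁅L,b₂⁆ = 2·a₂, ⁅L,b₃⁆ = 3·a₃, together with the relations ⁅a₀,b₀⁆ = 0, ⁅a₀,b₁⁆ + ⁅a₁,b₀⁆ = 0, ⁅a₀,b₂⁆ + ⁅a₁,b₁⁆ + ⁅a₂,b₀⁆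 = 0, ⁅a₀,b₃⁆ + ⁅a₁,b₂⁆ + ⁅a₂,b₁⁆ + ⁅a₃,b₀⁆ = 0, ⁅a₁,b₃⁆ + ⁅a₂,b₂⁆ + ⁅a₃,b₁⁆ = 0, ⁅a₂,b₃⁆ + ⁅a₃,b₂⁆ = 0, and ⁅a₃,b₃⁆ = 0. Then every bracket among the eight elements a₀, a₁, a₂, a₃, b₀, b₁, b₂, b₃ vanishes: ⁅a_j,a_k⁆ = 0, ⁅a_j,b_k⁆ = 0, and ⁅b_j,b_k⁆ = 0 for all j, k ∈ {0,1,2,3}. -/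
set_option linter.unusedSimpArgs false

/-- Apply `ad L` to a vanishing bracket. -/
theorem bracket_step {𝔤 : Type*} [LieRing 𝔤] (L x y x' y' : 𝔤) (hx : ⁅L, x⁆ = x') (hy : ⁅L, y⁆ = y')
    (h : ⁅x, y⁆ = 0) : ⁅x', y⁆ + ⁅x, y'⁆ = 0 := by
  have := leibniz_lie L x y
  rw [h, lie_zero, hx, hy] at this
  exact this.symm

/-- The nine-element closed prolongation Lie algebra of Appendix A for the
continuous Toda equation `u_tt = (e^u)_xx` (truncation `a_j = b_j = 0`, `j ≥ 4`):
every bracket among `a₀, a₁, a₂, a₃, b₀, b₁, b₂, b₃` vanishes. -/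
theorem nine_element_prolongation_algebra {𝔤 : Type*} [LieRing 𝔤] [LieAlgebra ℝ 𝔤]
    (L a₀ a₁ a₂ a₃ b₀ b₁ b₂ b₃ : 𝔤)
    (h1 : ⁅b₀, L⁆ = 0)
    (h2 : ⁅L, a₀⁆ = b₁)
    (h3 : ⁅L, a₁⁆ = (2 : ℝ) • b₂)
    (h4 : ⁅L, a₂⁆ = (3 : ℝ) • b₃)
    (h5 : ⁅L, a₃⁆ = 0)
    (h6 : ⁅L, b₁⁆ = a₁)
    (h7 : ⁅L, b₂⁆ = (2 : ℝ) • a₂)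
    (h8 : ⁅L, b₃⁆ = (3 : ℝ) • a₃)
    (h9 : ⁅a₀, b₀⁆ = 0)
    (h10 : ⁅a₀, b₁⁆ + ⁅a₁, b₀⁆ = 0)
    (h11 : ⁅a₀, b₂⁆ + ⁅a₁, b₁⁆ + ⁅a₂, b₀⁆ = 0)
    (h12 : ⁅a₀, b₃⁆ + ⁅a₁, b₂⁆ + ⁅a₂, b₁⁆ + ⁅a₃, b₀⁆ = 0)
    (h13 : ⁅a₁, b₃⁆ + ⁅a₂, b₂⁆ + ⁅a₃, b₁⁆ = 0)
    (h14 : ⁅a₂, b₃⁆ + ⁅a₃, b₂⁆ = 0)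
    (h15 : ⁅a₃, b₃⁆ = 0) :
    ∀ j k : Fin 4,
      ⁅![a₀, a₁, a₂, a₃] j, ![a₀, a₁, a₂, a₃] k⁆ = 0 ∧
      ⁅![a₀, a₁, a₂, a₃] j, ![b₀, b₁, b₂, b₃] k⁆ = 0 ∧
      ⁅![b₀, b₁, b₂, b₃] j, ![b₀, b₁, b₂, b₃] k⁆ = 0 := by
  obtain ⟨v3, e3⟩ : ∃ v, v = (2 : ℝ) • b₂ := ⟨_, rfl⟩
  obtain ⟨v4, e4⟩ : ∃ v, v = (4 : ℝ) • a₂ := ⟨_, rfl⟩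
  obtain ⟨v5, e5⟩ : ∃ v, v = (12 : ℝ) • b₃ := ⟨_, rfl⟩
  obtain ⟨v6, e6⟩ : ∃ v, v = (36 : ℝ) • a₃ := ⟨_, rfl⟩
  have f3 : b₂ = (1/2 : ℝ) • v3 := by rw [e3]; module
  have f4 : a₂ = (1/4 : ℝ) • v4 := by rw [e4]; module
  have f5 : b₃ = (1/12 : ℝ) • v5 := by rw [e5]; module
  have f6 : a₃ = (1/36 : ℝ) • v6 := by rw [e6]; module
  have d2 : ⁅L, a₁⁆ = v3 := by rw [e3, h3]
  have d3 : ⁅L, v3⁆ = v4 := by rw [e3, e4, lie_smul, h7]; module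
  have d4 : ⁅L, v4⁆ = v5 := by rw [e4, e5, lie_smul, h4]; module
  have d5 : ⁅L, v5⁆ = v6 := by rw [e5, e6, lie_smul, h8]; module
  have d6 : ⁅L, v6⁆ = 0 := by rw [e6, lie_smul, h5, smul_zero]
  have dc : ⁅L, b₀⁆ = 0 := by rw [← lie_skew, h1, neg_zero]
  clear e3 e4 e5 e6 h3 h4 h5 h7 h8 h1
  subst f3 f4 f5 f6
  simp only [smul_lie, lie_smul] at h10 h11 h12
  have c0 := h9
  have c1 : ⁅b₁, b₀⁆ = 0 := by simpa using bracket_step L _ _ _ _ h2 dc c0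
  have c2 : ⁅a₁, b₀⁆ = 0 := by simpa using bracket_step L _ _ _ _ h6 dc c1
  have c3 : ⁅v3, b₀⁆ = 0 := by simpa using bracket_step L _ _ _ _ d2 dc c2
  have c4 : ⁅v4, b₀⁆ = 0 := by simpa using bracket_step L _ _ _ _ d3 dc c3
  have c5 : ⁅v5, b₀⁆ = 0 := by simpa using bracket_step L _ _ _ _ d4 dc c4
  have c6 : ⁅v6, b₀⁆ = 0 := by simpa using bracket_step L _ _ _ _ d5 dc c5
  have w01 : ⁅a₀, b₁⁆ = 0 := by simpa [c2] using h10
  have s01 := bracket_step L _ _ _ _ h2 h6 w01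
  have w02 : ⁅a₀, a₁⁆ = 0 := by simpa using s01
  have s02 := bracket_step L _ _ _ _ h2 d2 w02
  rw [← lie_skew a₁ b₁, c4] at h11
  have w12 : ⁅b₁, a₁⁆ = 0 := by 
      have q : ⁅b₁, a₁⁆ = (1/3 : ℝ) • (⁅b₁, a₁⁆ + ⁅a₀, v3⁆)
          - (2/3 : ℝ) • ((1/2 : ℝ) • ⁅a₀, v3⁆ + -⁅b₁, a₁⁆ + (1/4 : ℝ) • 0) := by module
      rw [q, s02, h11, smul_zero, smul_zero, sub_zero]
  have s12 := bracket_step L _ _ _ _ h6 d2 w12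
  have w03 : ⁅a₀, v3⁆ = 0 := by simpa [w12] using s02
  have s03 := bracket_step L _ _ _ _ h2 d3 w03
  have w13 : ⁅b₁, v3⁆ = 0 := by simpa using s12
  have s13 := bracket_step L _ _ _ _ h6 d3 w13
  have w04 : ⁅a₀, v4⁆ = 0 := by simpa [w13] using s03
  have s04 := bracket_step L _ _ _ _ h2 d4 w04
  rw [← lie_skew v4 b₁, c6] at h12
  have w14 : ⁅b₁, v4⁆ = 0 := by
    have q5 : ⁅a₀, v5⁆ = -⁅b₁, v4⁆ := by rw [eq_neg_iff_add_eq_zero, add_comm]; exact s04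
    have q3 : ⁅a₁, v3⁆ = -⁅b₁, v4⁆ := by rw [eq_neg_iff_add_eq_zero]; exact s13
    rw [q5, q3] at h12
    have : (5/6 : ℝ) • ⁅b₁, v4⁆ = 0 := by rw [← neg_eq_zero, ← h12]; module
    exact (smul_eq_zero.mp this).resolve_left (by norm_num)
  have s14 := bracket_step L _ _ _ _ h6 d4 w14
  have w05 : ⁅a₀, v5⁆ = 0 := by simpa [w14] using s04
  have s05 := bracket_step L _ _ _ _ h2 d5 w05
  have w23 : ⁅a₁, v3⁆ = 0 := by simpa [w14] using s13
  have s23 := bracket_step L _ _ _ _ d2 d3 w23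
  have w24 : ⁅a₁, v4⁆ = 0 := by simpa using s23
  have s24 := bracket_step L _ _ _ _ d2 d4 w24
  have w15 : ⁅b₁, v5⁆ = 0 := by simpa [w24] using s14
  have s15 := bracket_step L _ _ _ _ h6 d5 w15
  have w06 : ⁅a₀, v6⁆ = 0 := by simpa [w15] using s05
  have s06 := bracket_step L _ _ _ _ h2 d6 w06
  have w16 : ⁅b₁, v6⁆ = 0 := by simpa using s06
  have s16 := bracket_step L _ _ _ _ h6 d6 w16
  have w25 : ⁅a₁, v5⁆ = 0 := by simpa [w16] using s15
  have s25 := bracket_step L _ _ _ _ d2 d5 w25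
  have w34 : ⁅v3, v4⁆ = 0 := by simpa [w25] using s24
  have s34 := bracket_step L _ _ _ _ d3 d4 w34
  have w26 : ⁅a₁, v6⁆ = 0 := by simpa using s16
  have s26 := bracket_step L _ _ _ _ d2 d6 w26
  have w35 : ⁅v3, v5⁆ = 0 := by simpa [w26] using s25
  have s35 := bracket_step L _ _ _ _ d3 d5 w35
  have w36 : ⁅v3, v6⁆ = 0 := by simpa using s26
  have s36 := bracket_step L _ _ _ _ d3 d6 w36
  have w45 : ⁅v4, v5⁆ = 0 := by simpa [w36] using s35
  have s45 := bracket_step L _ _ _ _ d4 d5 w45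
  have w46 : ⁅v4, v6⁆ = 0 := by simpa using s36
  have s46 := bracket_step L _ _ _ _ d4 d6 w46
  have w56 : ⁅v5, v6⁆ = 0 := by simpa using s46
  have s56 := bracket_step L _ _ _ _ d5 d6 w56
  have sk : ∀ x y : 𝔤, ⁅x, y⁆ = 0 → ⁅y, x⁆ = 0 := fun x y h => by rw [← lie_skew, h, neg_zero]
  intro j k
  fin_cases j <;> fin_cases k <;>
    simp [w01, w02, w03, w04, w05, w06, w12, w13, w14, w15, w16, w23, w24, w25, w26, w34, w35, w36, w45, w46, w56, c0, c1, c2, c3, c4, c5, c6,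
      sk _ _ w01, sk _ _ w02, sk _ _ w03, sk _ _ w04, sk _ _ w05, sk _ _ w06, sk _ _ w12, sk _ _ w13, sk _ _ w14, sk _ _ w15, sk _ _ w16, sk _ _ w23, sk _ _ w24, sk _ _ w25, sk _ _ w26, sk _ _ w34, sk _ _ w35, sk _ _ w36, sk _ _ w45, sk _ _ w46, sk _ _ w56, sk _ _ c0, sk _ _ c1, sk _ _ c2, sk _ _ c3, sk _ _ c4, sk _ _ c5, sk _ _ c6]
end

section
/- Let 𝔤 be a Lie algebra over ℝ, let L, b₀ ∈ 𝔤 with ⁅b₀,L⁆ = 0, and let (a_k)_{k≥0}, (b_k)_{k≥1} be families of elements of 𝔤 such that ⁅L,b_k⁆ = k·a_k and ⁅L,a_{k−1}⁆ = k·b_k for every integer k ≥ 1. Then for every integer k ≥ 1: (k!)²·⁅b₀,a_k⁆ = (ad L)^{2(k−1)} ⁅b₀,a₁⁆, where ad L denotes the adjoint map x ↦ ⁅L,x⁆ and (ad L)^m its m-fold iterate. Equivalently, ⁅b₀,a_k⁆ is obtained from ⁅b₀,a₁⁆ by applying ad L exactly 2(k−1) times and dividing by (k!)². -/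
/-- Relation (B6) of Appendix A: if `⁅b₀,L⁆ = 0`, `⁅L,b_k⁆ = k a_k` and
`⁅L,a_{k−1}⁆ = k b_k` for all `k ≥ 1`, then for every `k ≥ 1` one has
`(k!)²·⁅b₀,a_k⁆ = (ad L)^{2(k−1)} ⁅b₀,a₁⁆`. -/
theorem prolongation_relation_B6 {𝔤 : Type*} [LieRing 𝔤] [LieAlgebra ℝ 𝔤]
    (L b₀ : 𝔤) (a : ℕ → 𝔤) (b : ℕ → 𝔤)
    (h0 : ⁅b₀, L⁆ = 0)
    (hb : ∀ k : ℕ, 1 ≤ k → ⁅L, b k⁆ = (k : ℝ) • a k)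
    (ha : ∀ k : ℕ, 1 ≤ k → ⁅L, a (k - 1)⁆ = (k : ℝ) • b k) :
    ∀ k : ℕ, 1 ≤ k →
      ((Nat.factorial k : ℝ) ^ 2) • ⁅b₀, a k⁆ =
        (fun x => ⁅L, x⁆)^[2 * (k - 1)] ⁅b₀, a 1⁆ := by
  have hc : ∀ x : 𝔤, ⁅L, ⁅b₀, x⁆⁆ = ⁅b₀, ⁅L, x⁆⁆ := by
    intro x
    rw [leibniz_lie b₀ L x, h0, zero_lie, zero_add]
  intro k hk
  induction k, hk using Nat.le_induction with
  | base => simp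
  | succ n hn ih =>
    have e : 2 * (n + 1 - 1) = (2 * (n - 1)) + 1 + 1 := by omega
    have ha' := ha (n + 1) (by omega)
    have hb' := hb (n + 1) (by omega)
    rw [Nat.add_sub_cancel] at ha'
    rw [e, Function.iterate_succ_apply', Function.iterate_succ_apply', ← ih]
    simp only [lie_smul, hc, ha', hb', smul_smul]
    congr 1
    rw [Nat.factorial_succ]
    push_cast
    ring
end

section
/- Let c > 0 and t₀ ∈ ℝ, and let Ω = {(x,t) ∈ ℝ² : x > 0 and cos(√c·(t − t₀)) > 0}. Then the function u(x,t) = 2·ln(√c·x / cos(√c·(t − t₀))) satisfies the continuous Toda equation u_tt = (e^u)_xx at every point of Ω. -/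
/-- The exact solution (86) of the continuous Toda equation `u_tt = (e^u)_xx`:
`u = 2 ln(√c x / cos(√c (t−t₀)))` on the region `x > 0`, `cos(√c (t−t₀)) > 0`. -/
theorem exact_solution_toda (c : ℝ) (hc : 0 < c) (t₀ : ℝ) :
    ∀ x t : ℝ, 0 < x → 0 < Real.cos (Real.sqrt c * (t - t₀)) →
      deriv (fun t' => deriv (fun t'' =>
          2 * Real.log (Real.sqrt c * x / Real.cos (Real.sqrt c * (t'' - t₀)))) t') t
        = deriv (fun x' => deriv (fun x'' => Real.exp
          (2 * Real.log (Real.sqrt c * x'' / Real.cos (Real.sqrt c * (t - t₀))))) x') x := by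
  intro x t hx hcos
  have hs : 0 < Real.sqrt c := Real.sqrt_pos.mpr hc
  set s := Real.sqrt c with hsdef
  have hlin : ∀ y : ℝ, HasDerivAt (fun t' : ℝ => s * (t' - t₀)) s y := fun y => by
    simpa using ((hasDerivAt_id y).sub_const t₀).const_mul s
  have hL : (fun t' => deriv (fun t'' =>
      2 * Real.log (s * x / Real.cos (s * (t'' - t₀)))) t')
      =ᶠ[nhds t] fun t' => 2 * s * Real.tan (s * (t' - t₀)) := by
    have hopen : ∀ᶠ y in nhds t, 0 < Real.cos (s * (y - t₀)) := by
      have hcont : Continuous fun y : ℝ => Real.cos (s * (y - t₀)) := by fun_prop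
      exact hcont.continuousAt.eventually (lt_mem_nhds hcos)
    filter_upwards [hopen] with y hy
    have h1 := (hlin y).cos
    have h2 := (((hasDerivAt_const y (s * x)).fun_div h1 hy.ne').log
      (div_pos (mul_pos hs hx) hy).ne').const_mul 2
    rw [h2.deriv, Real.tan_eq_sin_div_cos]
    field_simp
    ring
  have hR : (fun x' => deriv (fun x'' => Real.exp
      (2 * Real.log (s * x'' / Real.cos (s * (t - t₀))))) x')
      =ᶠ[nhds x] fun x' => 2 * (s / Real.cos (s * (t - t₀))) ^ 2 * x' := by
    filter_upwards [lt_mem_nhds hx] with y hy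
    have he : (fun x'' => Real.exp (2 * Real.log (s * x'' / Real.cos (s * (t - t₀)))))
        =ᶠ[nhds y] fun x'' => (s / Real.cos (s * (t - t₀))) ^ 2 * x'' ^ 2 := by
      filter_upwards [lt_mem_nhds hy] with z hz
      rw [two_mul, Real.exp_add, Real.exp_log (div_pos (mul_pos hs hz) hcos)]
      ring
    rw [he.deriv_eq, ((hasDerivAt_pow 2 y).const_mul _).deriv]
    norm_num
    ring
  rw [hL.deriv_eq, hR.deriv_eq]
  have h3 := ((Real.hasDerivAt_tan hcos.ne').comp t (hlin t)).const_mul (2 * s)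
  have h4 := (hasDerivAt_id x).const_mul (2 * (s / Real.cos (s * (t - t₀))) ^ 2)
  refine h3.deriv.trans (Eq.trans ?_ h4.deriv.symm)
  field_simp
end

section
/- Let ε ∈ ℝ, let I ⊂ ℝ be an open interval, and let ρ : I → ℝ be twice differentiable with ρ(t) > 0 for all t ∈ I. Define u(x,t) = 2·ln(x/ρ(t)) for x > 0 and t ∈ I. Then u satisfies u_tt + ε·u_t = (e^u)_xx at every point (x,t) with x > 0, t ∈ I, if and only if ρ satisfies the reduced equation (ρ'(t))² − ρ(t)·ρ''(t) − ε·ρ(t)·ρ'(t) = 1 for all t ∈ I. Moreover, writing ρ = e^w with w : I → ℝ twice differentiable, this reduced equation is equivalent to the modified Liouville equation w''(t) + ε·w'(t) = −e^{−2w(t)}. -/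
/-- The symmetry reduction (82)-(84) of `u_tt + ε u_t = (e^u)_xx` under the
generator `X₄ = x∂_x + 2∂_u`: for `u(x,t) = 2 ln(x/ρ(t))` the PDE is equivalent
to the reduced equation `ρ'² − ρρ'' − ερρ' = 1`, which under `ρ = e^w` becomes the
modified Liouville equation `w'' + εw' = −e^{−2w}`. -/
theorem symmetry_reduction_X4 (ε a b : ℝ) (ρ : ℝ → ℝ)
    (hρpos : ∀ t ∈ Set.Ioo a b, 0 < ρ t)
    (hρ1 : ∀ t ∈ Set.Ioo a b, DifferentiableAt ℝ ρ t)
    (hρ2 : ∀ t ∈ Set.Ioo a b, DifferentiableAt ℝ (deriv ρ) t) :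
    ((∀ x : ℝ, 0 < x → ∀ t ∈ Set.Ioo a b,
        deriv (fun t' => deriv (fun t'' => 2 * Real.log (x / ρ t'')) t') t
          + ε * deriv (fun t' => 2 * Real.log (x / ρ t')) t
        = deriv (fun x' => deriv (fun x'' => Real.exp (2 * Real.log (x'' / ρ t))) x') x)
      ↔ (∀ t ∈ Set.Ioo a b,
          (deriv ρ t) ^ 2 - ρ t * deriv (deriv ρ) t - ε * ρ t * deriv ρ t = 1)) ∧
    (∀ w : ℝ → ℝ,
      (∀ t ∈ Set.Ioo a b, DifferentiableAt ℝ w t) →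
      (∀ t ∈ Set.Ioo a b, DifferentiableAt ℝ (deriv w) t) →
      (∀ t ∈ Set.Ioo a b, ρ t = Real.exp (w t)) →
      ((∀ t ∈ Set.Ioo a b,
          (deriv ρ t) ^ 2 - ρ t * deriv (deriv ρ) t - ε * ρ t * deriv ρ t = 1)
        ↔ (∀ t ∈ Set.Ioo a b,
            deriv (deriv w) t + ε * deriv w t = -Real.exp (-2 * w t)))) := by
  constructor
  · have key : ∀ x : ℝ, 0 < x → ∀ t ∈ Set.Ioo a b,
        (deriv (fun t' => deriv (fun t'' => 2 * Real.log (x / ρ t'')) t') t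
          + ε * deriv (fun t' => 2 * Real.log (x / ρ t')) t
        = deriv (fun x' => deriv (fun x'' => Real.exp (2 * Real.log (x'' / ρ t))) x') x
        ↔ (deriv ρ t) ^ 2 - ρ t * deriv (deriv ρ) t - ε * ρ t * deriv ρ t = 1) := by
      intro x hx t ht
      have h1 : ∀ s ∈ Set.Ioo a b,
          deriv (fun t'' => 2 * Real.log (x / ρ t'')) s = -2 * (deriv ρ s / ρ s) := by
        intro s hs
        have hp := hρpos s hs
        have hd : HasDerivAt (fun t'' => 2 * Real.log (x / ρ t''))
            (2 * (((0 * ρ s - x * deriv ρ s) / ρ s ^ 2) / (x / ρ s))) s :=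
          ((((hasDerivAt_const s x).div (hρ1 s hs).hasDerivAt hp.ne').log
            (div_pos hx hp).ne').const_mul 2)
        rw [hd.deriv]
        field_simp
        ring
      have hp := hρpos t ht
      have h2 : deriv (fun t' => deriv (fun t'' => 2 * Real.log (x / ρ t'')) t') t
          = -2 * ((deriv (deriv ρ) t * ρ t - deriv ρ t * deriv ρ t) / ρ t ^ 2) := by
        have he : (fun t' => deriv (fun t'' => 2 * Real.log (x / ρ t'')) t')
            =ᶠ[nhds t] (fun s => -2 * (deriv ρ s / ρ s)) := by
          filter_upwards [isOpen_Ioo.mem_nhds ht] with s hs using h1 s hs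
        rw [he.deriv_eq]
        exact (((hρ2 t ht).hasDerivAt.div (hρ1 t ht).hasDerivAt hp.ne').const_mul (-2)).deriv
      have h3 : ∀ y : ℝ, 0 < y →
          deriv (fun x'' => Real.exp (2 * Real.log (x'' / ρ t))) y = 2 / ρ t ^ 2 * y := by
        intro y hy
        have he : (fun x'' => Real.exp (2 * Real.log (x'' / ρ t)))
            =ᶠ[nhds y] (fun z => z ^ 2 / ρ t ^ 2) := by
          filter_upwards [isOpen_Ioi.mem_nhds (Set.mem_Ioi.mpr hy)] with z hz
          have hz' : 0 < z / ρ t := div_pos hz hp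
          rw [two_mul, Real.exp_add, Real.exp_log hz']
          ring
        rw [he.deriv_eq, ((hasDerivAt_pow 2 y).div_const (ρ t ^ 2)).deriv]
        push_cast
        ring
      have h4 : deriv (fun x' => deriv (fun x'' => Real.exp (2 * Real.log (x'' / ρ t))) x') x
          = 2 / ρ t ^ 2 := by
        have he : (fun x' => deriv (fun x'' => Real.exp (2 * Real.log (x'' / ρ t))) x')
            =ᶠ[nhds x] (fun y => 2 / ρ t ^ 2 * y) := by
          filter_upwards [isOpen_Ioi.mem_nhds (Set.mem_Ioi.mpr hx)] with y hy using h3 y hy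
        rw [he.deriv_eq, ((hasDerivAt_id' x).const_mul (2 / ρ t ^ 2)).deriv, mul_one]
      rw [h2, h1 t ht, h4]
      have e : -2 * ((deriv (deriv ρ) t * ρ t - deriv ρ t * deriv ρ t) / ρ t ^ 2)
          + ε * (-2 * (deriv ρ t / ρ t))
          = 2 / ρ t ^ 2 *
            ((deriv ρ t) ^ 2 - ρ t * deriv (deriv ρ) t - ε * ρ t * deriv ρ t) := by
        field_simp
        ring
      rw [e]
      have hne : 2 / ρ t ^ 2 ≠ 0 := by positivity
      exact mul_eq_left₀ hne
    exact ⟨fun h t ht => (key 1 one_pos t ht).1 (h 1 one_pos t ht),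
      fun h x hx t ht => (key x hx t ht).2 (h t ht)⟩
  · intro w hw1 hw2 hw
    refine forall₂_congr fun t ht => ?_
    have h1 : ∀ s ∈ Set.Ioo a b, deriv ρ s = Real.exp (w s) * deriv w s := by
      intro s hs
      have he : ρ =ᶠ[nhds s] (fun r => Real.exp (w r)) := by
        filter_upwards [isOpen_Ioo.mem_nhds hs] with r hr using hw r hr
      rw [he.deriv_eq]
      exact (hw1 s hs).hasDerivAt.exp.deriv
    have h2 : deriv (deriv ρ) t = Real.exp (w t) * deriv w t * deriv w t
        + Real.exp (w t) * deriv (deriv w) t := by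
      have he : deriv ρ =ᶠ[nhds t] (fun r => Real.exp (w r) * deriv w r) := by
        filter_upwards [isOpen_Ioo.mem_nhds ht] with r hr using h1 r hr
      rw [he.deriv_eq]
      exact ((hw1 t ht).hasDerivAt.exp.mul (hw2 t ht).hasDerivAt).deriv
    have h3 : Real.exp (-2 * w t) = (Real.exp (w t) ^ 2)⁻¹ := by
      rw [← Real.exp_nat_mul, ← Real.exp_neg]
      push_cast
      ring_nf
    rw [h2, h1 t ht, hw t ht, h3]
    have hE := Real.exp_pos (w t)
    generalize Real.exp (w t) = E at hE
    have e : (E * deriv w t) ^ 2 - E * (E * deriv w t * deriv w t + E * deriv (deriv w) t)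
        - ε * E * (E * deriv w t) = -(E ^ 2 * (deriv (deriv w) t + ε * deriv w t)) := by ring
    rw [e]
    have hE2 : E ^ 2 ≠ 0 := by positivity
    constructor
    · intro h
      field_simp
      linarith
    · intro h
      rw [h]
      field_simp
end

section
/- Let ε, v, c₀ ∈ ℝ and let U : ℝ → ℝ be twice differentiable satisfying the first-order ordinary differential equation (v² − e^{U(σ)})·U'(σ) = ε·v·U(σ) + c₀ for all σ ∈ ℝ. Then the travelling-wave function u(x,t) = U(x − v·t) satisfies u_tt + ε·u_t = (e^u)_xx at every point (x,t) ∈ ℝ². -/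
/-- The travelling-wave reduction (Sec. V.C): if `U` is twice differentiable and
satisfies the reduced equation `(v² − e^U)U' = εvU + c₀` (Eq. (91)), then
`u(x,t) = U(x − vt)` satisfies `u_tt + ε u_t = (e^u)_xx` everywhere. -/
theorem travelling_wave_solution (ε v c₀ : ℝ) (U : ℝ → ℝ)
    (hU : Differentiable ℝ U) (hU' : Differentiable ℝ (deriv U))
    (hODE : ∀ σ : ℝ, (v ^ 2 - Real.exp (U σ)) * deriv U σ = ε * v * U σ + c₀) :
    ∀ x t : ℝ,
      deriv (fun t' => deriv (fun t'' => U (x - v * t'')) t') t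
        + ε * deriv (fun t' => U (x - v * t')) t
      = deriv (fun x' => deriv (fun x'' => Real.exp (U (x'' - v * t))) x') x := by
  intro x t
  have h1 : ∀ s, HasDerivAt U (deriv U s) s := fun s => (hU s).hasDerivAt
  have h2 : ∀ s, HasDerivAt (deriv U) (deriv (deriv U) s) s := fun s => (hU' s).hasDerivAt
  have ht : ∀ s, HasDerivAt (fun r : ℝ => x - v * r) (-v) s := fun s => by
    simpa using ((hasDerivAt_id s).const_mul v).const_sub x
  have hx : ∀ s, HasDerivAt (fun r : ℝ => r - v * t) 1 s := fun s =>
    (hasDerivAt_id s).sub_const (v * t)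
  have e1 : ∀ s, deriv (fun r => U (x - v * r)) s = deriv U (x - v * s) * (-v) := fun s =>
    ((h1 (x - v * s)).comp s (ht s)).deriv
  have e2 : deriv (fun s => deriv U (x - v * s) * (-v)) t
      = deriv (deriv U) (x - v * t) * (-v) * (-v) :=
    (((h2 (x - v * t)).comp t (ht t)).mul_const (-v)).deriv
  have e3 : ∀ s, deriv (fun r => Real.exp (U (r - v * t))) s
      = Real.exp (U (s - v * t)) * (deriv U (s - v * t) * 1) := fun s =>
    ((h1 (s - v * t)).comp s (hx s)).exp.deriv
  have e4 : deriv (fun s => Real.exp (U (s - v * t)) * (deriv U (s - v * t) * 1)) x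
      = Real.exp (U (x - v * t)) * (deriv U (x - v * t) * 1) * (deriv U (x - v * t) * 1)
        + Real.exp (U (x - v * t)) * (deriv (deriv U) (x - v * t) * 1 * 1) := by
    have a := ((h1 (x - v * t)).comp x (hx x)).exp
    have b := ((h2 (x - v * t)).comp x (hx x)).mul_const 1
    exact (a.mul b).deriv
  have hL := ((h1 (x - v * t)).exp.const_sub (v ^ 2)).mul (h2 (x - v * t))
  have hR := ((h1 (x - v * t)).const_mul (ε * v)).add_const c₀
  have hfun : ((fun s => v ^ 2 - Real.exp (U s)) * deriv U) = fun s => ε * v * U s + c₀ :=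
    funext hODE
  rw [hfun] at hL
  have key := hL.unique hR
  simp only [e1, e3]
  rw [e2, e4]
  linear_combination key
end

section
/- Define g : ℝ → ℝ by the everywhere-convergent series g(t) = Σ_{k=0}^{∞} e^{k·t}/(k!)². Then g is twice differentiable with g''(t) = e^t·g(t) for all t, and consequently the function y(x,t) = g(t)·sinh(x) satisfies the wave equation y_tt − e^t·y_xx = 0 at every point (x,t) ∈ ℝ². -/
/-- `g(t) = Σ_{k≥0} e^{kt}/(k!)²`, i.e. the modified Bessel function
`I₀(2e^{t/2}) = J₀(2i e^{t/2})`. -/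
noncomputable def besselSeries (t : ℝ) : ℝ :=
  ∑' k : ℕ, Real.exp (k * t) / ((Nat.factorial k : ℝ)) ^ 2

lemma bs_summable (j : ℕ) (t : ℝ) :
    Summable (fun k : ℕ => (k : ℝ) ^ j * (Real.exp (k * t) / ((Nat.factorial k : ℝ)) ^ 2)) := by
  refine Summable.of_nonneg_of_le (fun k => by positivity) (fun k => ?_)
    ((Real.summable_pow_div_factorial (Real.exp (t + 1))).mul_left (j.factorial : ℝ))
  have h1 : (k : ℝ) ^ j ≤ j.factorial * Real.exp k := by
    have := Real.pow_div_factorial_le_exp (k : ℝ) (by positivity) j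
    rwa [div_le_iff₀ (by positivity), mul_comm] at this
  have h2 : (1 : ℝ) ≤ (k.factorial : ℝ) := by exact_mod_cast Nat.one_le_iff_ne_zero.2 k.factorial_ne_zero
  have h3 : Real.exp (k * t) / ((k.factorial : ℝ)) ^ 2 ≤ Real.exp (k * t) / (k.factorial : ℝ) := by
    gcongr
    nlinarith
  calc _ ≤ (j.factorial * Real.exp k) * (Real.exp (k * t) / (k.factorial : ℝ)) := by gcongr
    _ = _ := by
      rw [← Real.exp_nat_mul, mul_add, Real.exp_add, mul_one]
      ring

lemma bs_hasDerivAt (j : ℕ) (t : ℝ) :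
    HasDerivAt (fun s : ℝ => ∑' k : ℕ, (k : ℝ) ^ j * (Real.exp (k * s) / ((Nat.factorial k : ℝ)) ^ 2))
      (∑' k : ℕ, (k : ℝ) ^ (j + 1) * (Real.exp (k * t) / ((Nat.factorial k : ℝ)) ^ 2)) t := by
  refine hasDerivAt_tsum_of_isPreconnected
    (g := fun (k : ℕ) (s : ℝ) => (k : ℝ) ^ j * (Real.exp (k * s) / ((Nat.factorial k : ℝ)) ^ 2))
    (g' := fun (k : ℕ) (s : ℝ) => (k : ℝ) ^ (j + 1) * (Real.exp (k * s) / ((Nat.factorial k : ℝ)) ^ 2))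
    (bs_summable (j + 1) (t + 1)) (isOpen_Iio (a := t + 1)) isPreconnected_Iio
    ?_ ?_ (y₀ := t) (by simp) (bs_summable j t) (by simp)
  · intro k y _
    have h : HasDerivAt (fun s : ℝ => Real.exp (k * s)) (Real.exp (k * y) * k) y := by
      simpa using ((hasDerivAt_id y).const_mul (k : ℝ)).exp
    refine ((h.div_const (((Nat.factorial k : ℝ)) ^ 2)).const_mul ((k : ℝ) ^ j)).congr_deriv ?_
    ring
  · intro k y hy
    rw [Real.norm_of_nonneg (by positivity)]
    have : y ≤ t + 1 := le_of_lt hy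
    gcongr

lemma bs_rec (t : ℝ) :
    ∑' k : ℕ, (k : ℝ) ^ 2 * (Real.exp (k * t) / ((Nat.factorial k : ℝ)) ^ 2)
      = Real.exp t * besselSeries t := by
  rw [(bs_summable 2 t).tsum_eq_zero_add, besselSeries, ← tsum_mul_left]
  simp only [Nat.cast_zero, ne_eq, OfNat.ofNat_ne_zero, not_false_eq_true, zero_pow, zero_mul,
    zero_add]
  refine tsum_congr fun k => ?_
  have : (k.factorial : ℝ) ≠ 0 := by positivity
  have : (k : ℝ) + 1 ≠ 0 := by positivity
  rw [Nat.factorial_succ]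
  push_cast
  rw [add_mul, Real.exp_add, one_mul]
  field_simp

/-- The solution (35): the series `g(t) = Σ e^{kt}/(k!)²` converges everywhere,
`g` is twice differentiable with `g'' = e^t g`, and `y(x,t) = g(t) sinh x`
satisfies the wave equation `y_tt − e^t y_xx = 0` (Eq. (36)). -/
theorem bessel_series_wave_equation :
    (∀ t : ℝ, Summable (fun k : ℕ => Real.exp (k * t) / ((Nat.factorial k : ℝ)) ^ 2)) ∧
    Differentiable ℝ besselSeries ∧
    Differentiable ℝ (deriv besselSeries) ∧
    (∀ t : ℝ, deriv (deriv besselSeries) t = Real.exp t * besselSeries t) ∧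
    (∀ x t : ℝ,
      deriv (fun t' => deriv (fun t'' => besselSeries t'' * Real.sinh x) t') t
        - Real.exp t * deriv (fun x' => deriv (fun x'' => besselSeries t * Real.sinh x'') x') x
      = 0) := by
  have e0 : besselSeries = fun s : ℝ => ∑' k : ℕ, (k : ℝ) ^ 0 *
      (Real.exp (k * s) / ((Nat.factorial k : ℝ)) ^ 2) := by
    funext s
    simp [besselSeries]
  have d0 : ∀ t, HasDerivAt besselSeries (∑' k : ℕ, (k : ℝ) ^ 1 *
      (Real.exp (k * t) / ((Nat.factorial k : ℝ)) ^ 2)) t := by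
    intro t
    rw [e0]
    exact bs_hasDerivAt 0 t
  have e1 : deriv besselSeries = fun s : ℝ => ∑' k : ℕ, (k : ℝ) ^ 1 *
      (Real.exp (k * s) / ((Nat.factorial k : ℝ)) ^ 2) := funext fun t => (d0 t).deriv
  have d1 : ∀ t, HasDerivAt (deriv besselSeries) (Real.exp t * besselSeries t) t := by
    intro t
    rw [e1, ← bs_rec]
    exact bs_hasDerivAt 1 t
  refine ⟨fun t => by simpa using bs_summable 0 t, fun t => (d0 t).differentiableAt,
    fun t => (d1 t).differentiableAt, fun t => (d1 t).deriv, fun x t => ?_⟩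
  have a1 : (fun t' => deriv (fun t'' => besselSeries t'' * Real.sinh x) t')
      = fun t' => deriv besselSeries t' * Real.sinh x :=
    funext fun s => ((d0 s).differentiableAt.hasDerivAt.mul_const _).deriv
  have a2 : (fun x' => deriv (fun x'' => besselSeries t * Real.sinh x'') x')
      = fun x' => besselSeries t * Real.cosh x' :=
    funext fun s => ((Real.hasDerivAt_sinh s).const_mul _).deriv
  rw [a1, a2, ((d1 t).mul_const _).deriv, ((Real.hasDerivAt_cosh x).const_mul _).deriv]
  ring
end
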